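/- arXiv:2110.01753 — 3 statements merged into one kernel-verified Lean document; each statement's English description precedes it below -/
import Mathlib

section
/- Let a, b ∈ k be nonzero and let n ≥ 2 be an integer. The k-subalgebra of k[x,y] generated by x², y² and a·x²y + b·xy^n is isomorphic, as a k-algebra, to k[X,Y,Z]/(Z² + X²Y + XY^n). -/
open MvPolynomial

theorem aux_scale {k : Type*} [Field k] [IsAlgClosed k] (a b : k)
    (ha : a ≠ 0) (hb : b ≠ 0) (n : ℕ) (hn : 2 ≤ n) :
    ∃ α β : k, α ≠ 0 ∧ β ≠ 0 ∧ α ^ 2 * β = a ^ 2 ∧ α * β ^ n = b ^ 2 := by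
  obtain ⟨β, hβ⟩ := IsAlgClosed.exists_pow_nat_eq (b ^ 4 / a ^ 2) (n := 2 * n - 1) (by omega)
  have hβ0 : β ≠ 0 := by
    rintro rfl
    rw [zero_pow (by omega)] at hβ
    have : b ^ 4 / a ^ 2 ≠ 0 := by positivity
    exact this hβ.symm
  refine ⟨b ^ 2 / β ^ n, β, by positivity, hβ0, ?_, by field_simp⟩
  have h1 : β ^ n * β ^ n = β ^ (2 * n - 1) * β := by
    rw [← pow_add, ← pow_succ]; congr 1; omega
  have h2 : (b ^ 2 / β ^ n) ^ 2 * β = b ^ 4 * β / (β ^ n * β ^ n) := by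
    field_simp
  rw [h2, h1, hβ]
  field_simp

/-- the map on two variables -/
noncomputable def psi {k : Type*} [Field k] (α β : k) :
    MvPolynomial (Fin 2) k →ₐ[k] MvPolynomial (Fin 2) k :=
  aeval ![C α * X 0 ^ 2, C β * X 1 ^ 2]

theorem psi_inj {k : Type*} [Field k] (α β : k) (hα : α ≠ 0) (hβ : β ≠ 0) :
    Function.Injective (psi α β) := by
  let s : MvPolynomial (Fin 2) k →ₐ[k] MvPolynomial (Fin 2) k := aeval ![C α * X 0, C β * X 1]
  let t : MvPolynomial (Fin 2) k →ₐ[k] MvPolynomial (Fin 2) k :=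
    aeval ![C α⁻¹ * X 0, C β⁻¹ * X 1]
  have hts : t.comp s = AlgHom.id k _ := by
    apply MvPolynomial.algHom_ext
    intro i
    fin_cases i
    · simp [s, t, ← mul_assoc, ← C_mul, hα]
    · simp [s, t, ← mul_assoc, ← C_mul, hβ]
  have hs : Function.Injective s := by
    intro p q h
    have := congrArg t h
    have e : ∀ p, t (s p) = p := fun p => DFunLike.congr_fun hts p
    rwa [e, e] at this
  have hc : psi α β = (expand 2).comp s := by
    apply MvPolynomial.algHom_ext
    intro i
    fin_cases i <;> simp [psi, s]
  rw [hc, AlgHom.coe_comp]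
  refine Function.Injective.comp ?_ hs
  intro p q h
  ext m
  have := congrArg (coeff (2 • m)) h
  simpa using this

theorem psi_deriv {k : Type*} [Field k] [CharP k 2] (α β : k) (p : MvPolynomial (Fin 2) k) :
    pderiv 0 (psi α β p) = 0 := by
  have h2 : (2 : MvPolynomial (Fin 2) k) = 0 := CharTwo.two_eq_zero
  induction p using MvPolynomial.induction_on with
  | C r => simp [psi]
  | add p q hp hq => simp [hp, hq]
  | mul_X p i hp =>
    rw [map_mul, Derivation.leibniz, hp]
    fin_cases i <;> simp [psi, Derivation.leibniz_pow, h2, pderiv_X]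

theorem stmt_6 (k : Type*) [Field k] [IsAlgClosed k] [CharP k 2] (a b : k)
    (ha : a ≠ 0) (hb : b ≠ 0) (n : ℕ) (hn : 2 ≤ n) :
    Nonempty
      ((Algebra.adjoin k
          ({X 0 ^ 2, X 1 ^ 2, C a * (X 0 ^ 2 * X 1) + C b * (X 0 * X 1 ^ n)} :
            Set (MvPolynomial (Fin 2) k))) ≃ₐ[k]
        (MvPolynomial (Fin 3) k ⧸
          Ideal.span {(X 2 : MvPolynomial (Fin 3) k) ^ 2 + X 0 ^ 2 * X 1 + X 0 * X 1 ^ n})) := by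
  obtain ⟨α, β, hα, hβ, h1, h2⟩ := aux_scale a b ha hb n hn
  have two : (2 : MvPolynomial (Fin 2) k) = 0 := CharTwo.two_eq_zero
  set w : MvPolynomial (Fin 2) k := C a * (X 0 ^ 2 * X 1) + C b * (X 0 * X 1 ^ n) with hw
  set F : MvPolynomial (Fin 3) k := X 2 ^ 2 + X 0 ^ 2 * X 1 + X 0 * X 1 ^ n with hF
  let φ : MvPolynomial (Fin 3) k →ₐ[k] MvPolynomial (Fin 2) k :=
    aeval ![C α * X 0 ^ 2, C β * X 1 ^ 2, w]
  let ι : MvPolynomial (Fin 2) k →ₐ[k] MvPolynomial (Fin 3) k := aeval ![X 0, X 1]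
  have hφ0 : φ (X 0) = C α * X 0 ^ 2 := by simp [φ]
  have hφ1 : φ (X 1) = C β * X 1 ^ 2 := by simp [φ]
  have hφ2 : φ (X 2) = w := by simp [φ]
  have hφι : ∀ p, φ (ι p) = psi α β p := by
    have : φ.comp ι = psi α β := by
      apply MvPolynomial.algHom_ext
      intro i
      fin_cases i <;> simp [φ, ι, psi]
    exact fun p => DFunLike.congr_fun this p
  have hφF : φ F = 0 := by
    rw [hF, map_add, map_add, map_mul, map_mul, map_pow, map_pow, map_pow, hφ0, hφ1, hφ2, hw]
    have e1 : (C α : MvPolynomial (Fin 2) k) ^ 2 * C β = C a ^ 2 := by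
      rw [← C_pow, ← C_pow, ← C_mul, h1]
    have e2 : (C α : MvPolynomial (Fin 2) k) * C β ^ n = C b ^ 2 := by
      rw [← C_pow, ← C_pow, ← C_mul, h2]
    rw [mul_pow (C β), ← pow_mul, mul_comm 2 n, pow_mul]
    linear_combination (X 0 ^ 4 * X 1 ^ 2) * e1 + (X 0 ^ 2 * (X 1 ^ n) ^ 2) * e2 +
      (C a * (X 0 ^ 2 * X 1) * (C b * (X 0 * X 1 ^ n)) + C a ^ 2 * X 0 ^ 4 * X 1 ^ 2
        + C b ^ 2 * X 0 ^ 2 * (X 1 ^ n) ^ 2) * two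
  have hred : ∀ P : MvPolynomial (Fin 3) k, ∃ A B : MvPolynomial (Fin 2) k,
      ∃ Q, P = ι A + ι B * X 2 + Q * F := by
    have hι0 : ι (X 0) = X 0 := by simp [ι]
    have hι1 : ι (X 1) = X 1 := by simp [ι]
    intro P
    induction P using MvPolynomial.induction_on with
    | C r => exact ⟨C r, 0, 0, by simp [ι]⟩
    | add p q hp hq =>
      obtain ⟨A, B, Q, h⟩ := hp
      obtain ⟨A', B', Q', h'⟩ := hq
      refine ⟨A + A', B + B', Q + Q', ?_⟩
      rw [h, h', map_add, map_add]; ring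
    | mul_X p i hp =>
      obtain ⟨A, B, Q, h⟩ := hp
      have hi : i = 0 ∨ i = 1 ∨ i = 2 := by fin_cases i <;> simp
      rcases hi with rfl | rfl | rfl
      · refine ⟨A * X 0, B * X 0, Q * X 0, ?_⟩
        rw [h, map_mul, map_mul, hι0]; ring
      · refine ⟨A * X 1, B * X 1, Q * X 1, ?_⟩
        rw [h, map_mul, map_mul, hι1]; ring
      · refine ⟨-(B * (X 0 ^ 2 * X 1 + X 0 * X 1 ^ n)), A, Q * X 2 + ι B, ?_⟩
        rw [h, map_neg, map_mul, map_add, map_mul, map_mul, map_pow, map_pow, hι0, hι1, hF]; ring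
  have hdw : pderiv 0 w = C b * X 1 ^ n := by
    rw [hw]
    simp [Derivation.leibniz, Derivation.leibniz_pow, two, pderiv_X]
  have hker : RingHom.ker φ = Ideal.span {F} := by
    apply le_antisymm
    · intro P hP
      rw [RingHom.mem_ker] at hP
      obtain ⟨A, B, Q, rfl⟩ := hred P
      rw [map_add, map_add, map_mul, map_mul, hφF, hφι, hφι, hφ2, mul_zero, add_zero] at hP
      have hd := congrArg (pderiv (R := k) (0 : Fin 2)) hP
      rw [map_add, Derivation.leibniz, psi_deriv, psi_deriv, hdw, map_zero, smul_zero, zero_add,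
        add_zero, smul_eq_mul] at hd
      have hne : (C b * X 1 ^ n : MvPolynomial (Fin 2) k) ≠ 0 :=
        mul_ne_zero (by simpa using hb) (pow_ne_zero _ (X_ne_zero _))
      have hB : psi α β B = 0 := (mul_eq_zero.mp hd).resolve_right hne
      rw [hB, zero_mul, add_zero] at hP
      have hB0 := (map_eq_zero_iff _ (psi_inj α β hα hβ)).mp hB
      have hA0 := (map_eq_zero_iff _ (psi_inj α β hα hβ)).mp hP
      rw [hA0, hB0, map_zero, zero_mul, zero_add, zero_add]
      exact Ideal.mul_mem_left _ _ (Ideal.mem_span_singleton_self F)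
    · rw [Ideal.span_le, Set.singleton_subset_iff]
      exact hφF
  have hrange : φ.range = Algebra.adjoin k {X 0 ^ 2, X 1 ^ 2, w} := by
    have e : φ.range = Algebra.adjoin k
        (Set.range ![C α * X 0 ^ 2, C β * X 1 ^ 2, w]) :=
      (Algebra.adjoin_range_eq_range_aeval k _).symm
    apply le_antisymm
    · rw [e]
      apply Algebra.adjoin_le
      rintro _ ⟨i, rfl⟩
      have hC : ∀ (c : k) (p : MvPolynomial (Fin 2) k),
          p ∈ Algebra.adjoin k ({X 0 ^ 2, X 1 ^ 2, w} : Set (MvPolynomial (Fin 2) k)) →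
          C c * p ∈ Algebra.adjoin k ({X 0 ^ 2, X 1 ^ 2, w} : Set (MvPolynomial (Fin 2) k)) := by
        intro c p hp
        rw [← smul_eq_C_mul]
        exact Subalgebra.smul_mem _ hp c
      fin_cases i
      · exact hC _ _ (Algebra.subset_adjoin (by simp))
      · exact hC _ _ (Algebra.subset_adjoin (by simp))
      · exact Algebra.subset_adjoin (by simp)
    · apply Algebra.adjoin_le
      rintro p (rfl | rfl | rfl)
      · refine ⟨C α⁻¹ * X 0, ?_⟩
        show φ _ = _
        rw [map_mul, hφ0, show φ (C α⁻¹) = C α⁻¹ from φ.commutes _, ← mul_assoc, ← C_mul,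
          inv_mul_cancel₀ hα, C_1, one_mul]
      · refine ⟨C β⁻¹ * X 1, ?_⟩
        show φ _ = _
        rw [map_mul, hφ1, show φ (C β⁻¹) = C β⁻¹ from φ.commutes _, ← mul_assoc, ← C_mul,
          inv_mul_cancel₀ hβ, C_1, one_mul]
      · exact ⟨X 2, hφ2⟩
  rw [← hker, ← hrange]
  exact ⟨(Ideal.quotientKerEquivRange φ).symm⟩
end

section
/- Let a, b ∈ k be nonzero. The k-subalgebra of k[x,y] generated by x², y² and a·x³ + b·xy³ is isomorphic, as a k-algebra, to k[X,Y,Z]/(Z² + X³ + XY³). -/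
open MvPolynomial

namespace Stmt9

variable {k : Type*} [Field k]

noncomputable def psi (m : k) : MvPolynomial (Fin 2) k →ₐ[k] MvPolynomial (Fin 2) k :=
  aeval ![X 0 ^ 2, C m * X 1 ^ 2]

noncomputable def phi (m c : k) : MvPolynomial (Fin 3) k →ₐ[k] MvPolynomial (Fin 2) k :=
  aeval ![X 0 ^ 2, C m * X 1 ^ 2, X 0 ^ 3 + C c * (X 0 * X 1 ^ 3)]

noncomputable def inc : MvPolynomial (Fin 2) k →ₐ[k] MvPolynomial (Fin 3) k :=
  aeval ![X 0, X 1]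

lemma phi_inc (m c : k) (A : MvPolynomial (Fin 2) k) : phi m c (inc A) = psi m A := by
  have : (phi m c).comp inc = psi m := by
    ext i
    fin_cases i <;> simp [phi, inc, psi]
  exact DFunLike.congr_fun this A

lemma psi_inj (m : k) (hm : m ≠ 0) : Function.Injective (psi m) := by
  have h2 : (psi m) = (expand 2).comp
      (aeval ![X 0, C m * X 1] : MvPolynomial (Fin 2) k →ₐ[k] MvPolynomial (Fin 2) k) := by
    ext i
    fin_cases i <;> simp [psi]
  have h3 : (aeval ![X 0, C m⁻¹ * X 1] : MvPolynomial (Fin 2) k →ₐ[k] _).comp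
      (aeval ![X 0, C m * X 1] : MvPolynomial (Fin 2) k →ₐ[k] MvPolynomial (Fin 2) k)
      = AlgHom.id k _ := by
    apply MvPolynomial.algHom_ext
    intro i
    fin_cases i
    · simp
    · simp [algebraMap_eq, ← mul_assoc, ← C_mul, hm]
  have h4 : Function.Injective
      (aeval ![X 0, C m * X 1] : MvPolynomial (Fin 2) k →ₐ[k] MvPolynomial (Fin 2) k) := by
    intro p q hpq
    have hp := DFunLike.congr_fun h3 p
    have hq := DFunLike.congr_fun h3 q
    rw [AlgHom.comp_apply, AlgHom.id_apply] at hp hq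
    rw [← hp, ← hq, hpq]
  intro p q hpq
  rw [h2] at hpq
  apply h4
  have h5 := hpq
  simp only [AlgHom.comp_apply] at h5
  exact expand_injective (R := k) (by norm_num) h5

lemma two_eq [CharP k 2] : (2 : MvPolynomial (Fin 2) k) = 0 := CharTwo.two_eq_zero

lemma pderiv_psi [CharP k 2] (m : k) (A : MvPolynomial (Fin 2) k) :
    pderiv 0 (psi m A) = 0 := by
  induction A using MvPolynomial.induction_on with
  | C r => simp [psi, algebraMap_eq]
  | add p q hp hq => simp [hp, hq]
  | mul_X p i hp =>
    rw [map_mul, Derivation.leibniz, hp]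
    fin_cases i <;> simp [psi, two_eq]

lemma division [CharP k 2] (p : MvPolynomial (Fin 3) k) :
    ∃ A B : MvPolynomial (Fin 2) k, p - (inc A + inc B * X 2) ∈
      Ideal.span {(X 2 : MvPolynomial (Fin 3) k) ^ 2 + X 0 ^ 3 + X 0 * X 1 ^ 3} := by
  induction p using MvPolynomial.induction_on with
  | C r => exact ⟨C r, 0, by simp [inc, algebraMap_eq]⟩
  | add p q hp hq =>
    obtain ⟨A, B, h⟩ := hp
    obtain ⟨A', B', h'⟩ := hq
    refine ⟨A + A', B + B', ?_⟩
    convert Ideal.add_mem _ h h' using 1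
    simp only [map_add]; ring
  | mul_X p i hp =>
    obtain ⟨A, B, h⟩ := hp
    have h0 : inc (X 0 : MvPolynomial (Fin 2) k) = X 0 := by simp [inc]
    have h1 : inc (X 1 : MvPolynomial (Fin 2) k) = X 1 := by simp [inc]
    fin_cases i
    · refine ⟨A * X 0, B * X 0, ?_⟩
      convert Ideal.mul_mem_right (X 0) _ h using 1
      simp only [map_mul, h0, Fin.zero_eta]; ring
    · refine ⟨A * X 1, B * X 1, ?_⟩
      convert Ideal.mul_mem_right (X 1) _ h using 1
      simp only [map_mul, h1, Fin.mk_one]; ring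
    · refine ⟨-(B * (X 0 ^ 3 + X 0 * X 1 ^ 3)), A, ?_⟩
      convert Ideal.add_mem _ (Ideal.mul_mem_right (X 2) _ h)
        (Ideal.mul_mem_left _ (inc B) (Ideal.subset_span (Set.mem_singleton _))) using 1
      simp only [map_mul, map_neg, map_add, map_pow, h1, h0, Fin.reduceFinMk]; ring

lemma ker_phi [CharP k 2] (m c : k) (hm : m ≠ 0) (hmc : m ^ 3 = c ^ 2) :
    RingHom.ker (phi m c) =
      Ideal.span {(X 2 : MvPolynomial (Fin 3) k) ^ 2 + X 0 ^ 3 + X 0 * X 1 ^ 3} := by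
  have hle : Ideal.span {(X 2 : MvPolynomial (Fin 3) k) ^ 2 + X 0 ^ 3 + X 0 * X 1 ^ 3} ≤
      RingHom.ker (phi m c) := by
    rw [Ideal.span_singleton_le_iff_mem, RingHom.mem_ker]
    have hC : (C m : MvPolynomial (Fin 2) k) ^ 3 = C c ^ 2 := by rw [← C_pow, hmc, C_pow]
    have e0 : phi m c (X 0) = X 0 ^ 2 := by simp [phi]
    have e1 : phi m c (X 1) = C m * X 1 ^ 2 := by simp [phi]
    have e2 : phi m c (X 2) = X 0 ^ 3 + C c * (X 0 * X 1 ^ 3) := by simp [phi]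
    simp only [map_add, map_mul, map_pow, e0, e1, e2]
    linear_combination (X 0 ^ 2 * X 1 ^ 6) * hC +
      (X 0 ^ 6 + C c * X 0 ^ 4 * X 1 ^ 3 + C c ^ 2 * X 0 ^ 2 * X 1 ^ 6) * (two_eq (k := k))
  apply le_antisymm _ hle
  intro p hp
  obtain ⟨A, B, h⟩ := division p
  have hk := hle h
  rw [RingHom.mem_ker] at hk hp
  have e2 : phi m c (X 2) = X 0 ^ 3 + C c * (X 0 * X 1 ^ 3) := by simp [phi]
  rw [map_sub, hp, map_add, map_mul, phi_inc, phi_inc, e2, zero_sub, neg_eq_zero] at hk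
  have hd := congrArg (pderiv 0) hk
  have hz : pderiv 0 (X 0 ^ 3 + C c * (X 0 * X 1 ^ 3) : MvPolynomial (Fin 2) k)
      = X 0 ^ 2 + C c * X 1 ^ 3 := by
    simp [pderiv_X]
    linear_combination (two_eq (k := k))
  rw [map_add, Derivation.leibniz, pderiv_psi, pderiv_psi, hz] at hd
  simp only [mul_zero, add_zero, zero_add, smul_eq_mul, map_zero] at hd
  have hne : (X 0 ^ 2 + C c * X 1 ^ 3 : MvPolynomial (Fin 2) k) ≠ 0 := by
    intro h0
    have := congrArg (MvPolynomial.eval ![1, 0]) h0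
    simp at this
  have hB : psi m B = 0 := (mul_eq_zero.mp hd).resolve_right hne
  rw [hB, zero_mul, add_zero] at hk
  have hA0 : A = 0 := psi_inj m hm (by rw [hk, map_zero])
  have hB0 : B = 0 := psi_inj m hm (by rw [hB, map_zero])
  simpa [hA0, hB0] using h

lemma range_phi (a b m : k) (ha : a ≠ 0) (hm : m ≠ 0) :
    (phi m (b / a)).range =
      Algebra.adjoin k ({X 0 ^ 2, X 1 ^ 2, C a * X 0 ^ 3 + C b * (X 0 * X 1 ^ 3)} :
          Set (MvPolynomial (Fin 2) k)) := by
  have hC : (C a : MvPolynomial (Fin 2) k) * (X 0 ^ 3 + C (b / a) * (X 0 * X 1 ^ 3)) =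
      C a * X 0 ^ 3 + C b * (X 0 * X 1 ^ 3) := by
    rw [mul_add, ← mul_assoc (C a) (C (b / a)), ← C_mul, mul_div_cancel₀ _ ha]
  have hC' : (X 0 ^ 3 + C (b / a) * (X 0 * X 1 ^ 3) : MvPolynomial (Fin 2) k) =
      a⁻¹ • (C a * X 0 ^ 3 + C b * (X 0 * X 1 ^ 3)) := by
    rw [← hC, ← smul_eq_C_mul (_ + _) a, smul_smul, inv_mul_cancel₀ ha, one_smul]
  apply le_antisymm
  · rw [phi, ← Algebra.adjoin_range_eq_range_aeval, Algebra.adjoin_le_iff]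
    rintro _ ⟨i, rfl⟩
    fin_cases i
    · exact Algebra.subset_adjoin (by simp)
    · change C m * X 1 ^ 2 ∈ Algebra.adjoin k ({X 0 ^ 2, X 1 ^ 2, C a * X 0 ^ 3 + C b * (X 0 * X 1 ^ 3)} :
          Set (MvPolynomial (Fin 2) k))
      rw [← smul_eq_C_mul (X 1 ^ 2) m]
      exact Subalgebra.smul_mem _ (Algebra.subset_adjoin (by simp)) _
    · change X 0 ^ 3 + C (b / a) * (X 0 * X 1 ^ 3) ∈ Algebra.adjoin k ({X 0 ^ 2, X 1 ^ 2, C a * X 0 ^ 3 + C b * (X 0 * X 1 ^ 3)} :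
          Set (MvPolynomial (Fin 2) k))
      rw [hC']
      exact Subalgebra.smul_mem _ (Algebra.subset_adjoin (by simp)) _
  · rw [Algebra.adjoin_le_iff]
    rintro _ (rfl | rfl | rfl)
    · exact ⟨X 0, by simp [phi]⟩
    · refine ⟨m⁻¹ • X 1, ?_⟩
      simp [phi, ← smul_eq_C_mul, smul_smul, hm]
    · refine ⟨a • X 2, ?_⟩
      change phi m (b / a) (a • X 2) = _
      rw [← hC, map_smul, smul_eq_C_mul]
      simp [phi]

end Stmt9

/-- For a, b ≠ 0, k[x², y², ax³ + bxy³] ≅ k[X,Y,Z]/(Z² + X³ + XY³). -/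
theorem stmt_9 (k : Type*) [Field k] [IsAlgClosed k] [CharP k 2] (a b : k)
    (ha : a ≠ 0) (hb : b ≠ 0) :
    Nonempty
      ((Algebra.adjoin k ({X 0 ^ 2, X 1 ^ 2, C a * X 0 ^ 3 + C b * (X 0 * X 1 ^ 3)} :
          Set (MvPolynomial (Fin 2) k))) ≃ₐ[k]
        (MvPolynomial (Fin 3) k ⧸
          Ideal.span {(X 2 : MvPolynomial (Fin 3) k) ^ 2 + X 0 ^ 3 + X 0 * X 1 ^ 3})) := by
  obtain ⟨m, hmc⟩ := IsAlgClosed.exists_pow_nat_eq ((b / a) ^ 2) (n := 3) (by norm_num)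
  have hm : m ≠ 0 := by
    rintro rfl
    have : (b / a) ^ 2 ≠ 0 := pow_ne_zero _ (div_ne_zero hb ha)
    exact this (by rw [← hmc]; norm_num)
  rw [← Stmt9.range_phi a b m ha hm, ← Stmt9.ker_phi m (b / a) hm hmc]
  exact ⟨(Ideal.quotientKerEquivRange (Stmt9.phi m (b / a))).symm⟩
end

section
/- Let a ∈ k be nonzero. The k-subalgebra of k[x,y] generated by x², y² and y³ + axy is isomorphic, as a k-algebra, to k[X,Y,Z]/(Z² + XY). -/
open MvPolynomial

lemma stmt_13_red {k : Type*} [Field k] (p : MvPolynomial (Fin 3) k) :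
    ∃ A B : MvPolynomial (Fin 2) k,
      p - (rename Fin.castSucc A + rename Fin.castSucc B * X 2) ∈
        Ideal.span {(X 2 : MvPolynomial (Fin 3) k) ^ 2 + X 0 * X 1} := by
  induction p using MvPolynomial.induction_on with
  | C c => exact ⟨C c, 0, by simp⟩
  | add p q hp hq =>
    obtain ⟨A, B, h⟩ := hp
    obtain ⟨A', B', h'⟩ := hq
    refine ⟨A + A', B + B', ?_⟩
    convert Ideal.add_mem _ h h' using 1
    simp only [map_add]
    ring
  | mul_X p i hp =>
    obtain ⟨A, B, h⟩ := hp
    have h0 : rename Fin.castSucc (X 0 : MvPolynomial (Fin 2) k) = X (0 : Fin 3) := by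
      rw [rename_X]; rfl
    have h1 : rename Fin.castSucc (X 1 : MvPolynomial (Fin 2) k) = X (1 : Fin 3) := by
      rw [rename_X]; rfl
    fin_cases i
    · refine ⟨A * X 0, B * X 0, ?_⟩
      convert Ideal.mul_mem_right (X 0) _ h using 1
      simp only [map_mul, h0]
      simp
      ring
    · refine ⟨A * X 1, B * X 1, ?_⟩
      convert Ideal.mul_mem_right (X 1) _ h using 1
      simp only [map_mul, h1]
      simp
      ring
    · refine ⟨-(B * X 0 * X 1), A, ?_⟩
      have hg := Ideal.mul_mem_left _ (rename Fin.castSucc B)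
        (Ideal.mem_span_singleton_self ((X 2 : MvPolynomial (Fin 3) k) ^ 2 + X 0 * X 1))
      convert Ideal.add_mem _ (Ideal.mul_mem_right (X 2) _ h) hg using 1
      simp only [map_mul, map_neg, h0, h1]
      simp
      ring

lemma stmt_13_inj {k : Type*} [Field k] [CharP k 2] (p : MvPolynomial (Fin 3) k)
    (hp : aeval (![X 0 ^ 2, X 1 ^ 2, X 0 * X 1] : Fin 3 → MvPolynomial (Fin 2) k) p = 0) :
    p ∈ Ideal.span {(X 2 : MvPolynomial (Fin 3) k) ^ 2 + X 0 * X 1} := by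
  have h2 : (2 : MvPolynomial (Fin 2) k) = 0 := CharTwo.two_eq_zero
  obtain ⟨A, B, h⟩ := stmt_13_red p
  have hle : ∀ q ∈ Ideal.span {(X 2 : MvPolynomial (Fin 3) k) ^ 2 + X 0 * X 1},
      aeval (![X 0 ^ 2, X 1 ^ 2, X 0 * X 1] : Fin 3 → MvPolynomial (Fin 2) k) q = 0 := by
    intro q hq
    obtain ⟨r, rfl⟩ := Ideal.mem_span_singleton.1 hq
    simp
    left
    linear_combination (X 0 ^ 2 * X 1 ^ 2) * h2
  have hren : ∀ A : MvPolynomial (Fin 2) k,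
      aeval (![X 0 ^ 2, X 1 ^ 2, X 0 * X 1] : Fin 3 → MvPolynomial (Fin 2) k)
        (rename Fin.castSucc A) = expand 2 A := by
    intro A
    rw [aeval_rename, expand, ← aeval_eq_bind₁]
    congr 2
    funext i
    fin_cases i <;> simp
  have hd : ∀ A : MvPolynomial (Fin 2) k, pderiv 0 (expand 2 A) = 0 := by
    intro A
    induction A using MvPolynomial.induction_on with
    | C c => simp
    | add p q hp hq => simp [hp, hq]
    | mul_X p i hp =>
      rw [map_mul, Derivation.leibniz, hp, expand_X, Derivation.leibniz_pow]
      simp [h2, two_smul, CharTwo.add_self_eq_zero]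
  have e := hle _ h
  rw [map_sub, hp, map_add, map_mul, hren, hren, aeval_X] at e
  have e1 : expand 2 A + expand 2 B * (X 0 * X 1) = 0 := by
    have e' : 0 - (expand 2 A + expand 2 B * (X 0 * X 1)) = 0 := e
    linear_combination -e'
  have e2 := congrArg (pderiv 0) e1
  have hinj : Function.Injective (expand 2 : MvPolynomial (Fin 2) k →ₐ[k] _) :=
    expand_injective (by norm_num)
  have hB : B = 0 := by
    rw [map_add, hd, Derivation.leibniz, hd, Derivation.leibniz] at e2
    have : expand 2 B = 0 := by simpa [pderiv_X] using e2
    exact hinj (by simpa using this)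
  have hA : A = 0 := by
    rw [hB] at e1
    exact hinj (by simpa using e1)
  simpa [hA, hB] using h

lemma stmt_13_iso {k R S : Type*} [Field k] [CommRing R] [Algebra k R] [CommRing S] [Algebra k S]
    (f : R →ₐ[k] S) (I : Ideal R) (T : Subalgebra k S) (h1 : RingHom.ker f = I)
    (h2 : f.range = T) : Nonempty (T ≃ₐ[k] (R ⧸ I)) := by
  subst h1 h2
  exact ⟨(Ideal.quotientKerEquivRange f).symm⟩

/-- For a ≠ 0, k[x², y², y³ + axy] ≅ k[X,Y,Z]/(Z² + XY). -/
theorem stmt_13 (k : Type*) [Field k] [IsAlgClosed k] [CharP k 2] (a : k) (ha : a ≠ 0) :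
    Nonempty
      ((Algebra.adjoin k ({X 0 ^ 2, X 1 ^ 2, X 1 ^ 3 + C a * (X 0 * X 1)} :
          Set (MvPolynomial (Fin 2) k))) ≃ₐ[k]
        (MvPolynomial (Fin 3) k ⧸
          Ideal.span {(X 2 : MvPolynomial (Fin 3) k) ^ 2 + X 0 * X 1})) := by
  have h2 : (2 : MvPolynomial (Fin 2) k) = 0 := CharTwo.two_eq_zero
  have hC : (C a : MvPolynomial (Fin 2) k) * C a⁻¹ = 1 := by
    rw [← C_mul, mul_inv_cancel₀ ha, C_1]
  let g : Fin 3 → MvPolynomial (Fin 2) k :=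
    ![X 1 ^ 4 + C a ^ 2 * X 0 ^ 2, X 1 ^ 2, X 1 ^ 3 + C a * (X 0 * X 1)]
  let ψ : MvPolynomial (Fin 2) k →ₐ[k] MvPolynomial (Fin 2) k :=
    aeval ![C a⁻¹ * (X 0 + X 1 ^ 2), X 1]
  have hψ : ψ.comp (aeval g) =
      aeval (![X 0 ^ 2, X 1 ^ 2, X 0 * X 1] : Fin 3 → MvPolynomial (Fin 2) k) := by
    apply MvPolynomial.algHom_ext
    intro i
    have hCa : ψ (C a) = C a := ψ.commutes a
    have hX0 : ψ (X 0) = C a⁻¹ * (X 0 + X 1 ^ 2) := by simp [ψ]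
    have hX1 : ψ (X 1) = X 1 := by simp [ψ]
    fin_cases i
    · simp [g, hCa, hX0, hX1]
      linear_combination (X 0 + X 1 ^ 2) ^ 2 * (C a * C a⁻¹ + 1) * hC
        + (X 1 ^ 4 + X 0 * X 1 ^ 2) * h2
    · simp [g, hX1]
    · simp [g, hCa, hX0, hX1]
      linear_combination (X 0 + X 1 ^ 2) * X 1 * hC + X 1 ^ 3 * h2
  have hker : RingHom.ker (aeval g : MvPolynomial (Fin 3) k →ₐ[k] _) =
      Ideal.span {(X 2 : MvPolynomial (Fin 3) k) ^ 2 + X 0 * X 1} := by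
    apply le_antisymm
    · intro p hp
      apply stmt_13_inj
      rw [← hψ, AlgHom.comp_apply, (RingHom.mem_ker).1 hp, map_zero]
    · rw [Ideal.span_singleton_le_iff_mem, RingHom.mem_ker]
      simp [g]
      linear_combination (X 1 ^ 6 + C a * X 0 * X 1 ^ 4 + C a ^ 2 * X 0 ^ 2 * X 1 ^ 2) * h2
  have hrange : (aeval g : MvPolynomial (Fin 3) k →ₐ[k] _).range =
      Algebra.adjoin k ({X 0 ^ 2, X 1 ^ 2, X 1 ^ 3 + C a * (X 0 * X 1)} :
          Set (MvPolynomial (Fin 2) k)) := by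
    rw [← Algebra.adjoin_range_eq_range_aeval]
    have hCm : ∀ (S : Subalgebra k (MvPolynomial (Fin 2) k)) (c : k), C c ∈ S :=
      fun S c => S.algebraMap_mem c
    apply le_antisymm
    · apply Algebra.adjoin_le
      rintro _ ⟨i, rfl⟩
      have m0 := Algebra.subset_adjoin (R := k) (s := ({X 0 ^ 2, X 1 ^ 2, X 1 ^ 3 + C a * (X 0 * X 1)} :
          Set (MvPolynomial (Fin 2) k))) (show X 0 ^ 2 ∈ _ by simp)
      have m1 := Algebra.subset_adjoin (R := k) (s := ({X 0 ^ 2, X 1 ^ 2, X 1 ^ 3 + C a * (X 0 * X 1)} :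
          Set (MvPolynomial (Fin 2) k))) (show X 1 ^ 2 ∈ _ by simp)
      fin_cases i
      · have := add_mem (pow_mem m1 2) (mul_mem (pow_mem (hCm _ a) 2) m0)
        rw [← pow_mul] at this
        exact this
      · exact m1
      · exact Algebra.subset_adjoin (by simp [g])
    · apply Algebra.adjoin_le
      have m : ∀ i, g i ∈ Algebra.adjoin k (Set.range g) :=
        fun i => Algebra.subset_adjoin ⟨i, rfl⟩
      rintro _ (rfl | rfl | rfl)
      · have := mul_mem (pow_mem (hCm _ a⁻¹) 2) (sub_mem (m 0) (pow_mem (m 1) 2))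
        rw [SetLike.mem_coe]
        convert this using 1
        simp only [g, Matrix.cons_val_zero, Matrix.cons_val_one]
        linear_combination -(X 0 ^ 2) * (C a * C a⁻¹ + 1) * hC
      · exact m 1
      · exact m 2
  exact stmt_13_iso (aeval g) _ _ hker hrange
end
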